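/- Let q be a prime power, 2r ≤ n ≤ m, 1 ≤ d ≤ r, and suppose either d = r or m ≥ m₀ where m₀ = (n−r)(r−d+1) + r + 1. If 𝒞 is a nonempty set of m×n matrices over GF(q), all of rank r, in which any two distinct elements X, Y satisfy rank(X−Y) ≥ d + r and which has cardinality |𝒞| = A_R(q,m,n,d+r,r), then R(𝒞) is a set of r-dimensional subspaces of GF(q)^n in which any two distinct subspaces are at injection distance ≥ d and |R(𝒞)| = A_C(q,n,r,d). -/

import Mathlib

open Module

noncomputable def injDist {F V : Type*} [Field F] [AddCommGroup V] [Module F V]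
    (U W : Submodule F V) : ℕ :=
  finrank F ↥(U ⊔ W) - min (finrank F ↥U) (finrank F ↥W)

def rowSpace {F : Type*} [CommRing F] {m n : ℕ} (X : Matrix (Fin m) (Fin n) F) :
    Submodule F (Fin n → F) :=
  LinearMap.range X.vecMulLinear

def colSpace {F : Type*} [CommRing F] {m n : ℕ} (X : Matrix (Fin m) (Fin n) F) :
    Submodule F (Fin m → F) :=
  LinearMap.range X.mulVecLin

noncomputable def minRankDist {F : Type*} [Field F] {m n : ℕ}
    (C : Set (Matrix (Fin m) (Fin n) F)) : ℕ :=
  sInf {e | ∃ X ∈ C, ∃ Y ∈ C, X ≠ Y ∧ (X - Y).rank = e}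

noncomputable def minInjDist {F V : Type*} [Field F] [AddCommGroup V] [Module F V]
    (S : Set (Submodule F V)) : ℕ :=
  sInf {e | ∃ U ∈ S, ∃ W ∈ S, U ≠ W ∧ injDist U W = e}

/-- Maximum cardinality of a nonempty code of `m × n` matrices whose ranks all lie in `I`
and in which any two distinct codewords are at rank distance at least `d`. -/
noncomputable def maxRankCode (F : Type*) [Field F] [Fintype F] (m n d : ℕ) (I : Set ℕ) : ℕ :=
  sSup {c : ℕ | ∃ C : Set (Matrix (Fin m) (Fin n) F), C.Nonempty ∧
    (∀ X ∈ C, X.rank ∈ I) ∧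
    (∀ X ∈ C, ∀ Y ∈ C, X ≠ Y → d ≤ (X - Y).rank) ∧ C.ncard = c}

/-- `A_R(q,m,n,d,r)` : maximum cardinality of a constant-rank code of constant rank `r`
and minimum rank distance at least `d` in `GF(q)^{m × n}`. -/
noncomputable def A_R (F : Type*) [Field F] [Fintype F] (m n d r : ℕ) : ℕ :=
  maxRankCode F m n d {r}

/-- `A_C(q,n,r,d)` : maximum cardinality of a constant-dimension code of dimension `r`
and minimum injection distance at least `d` in `GF(q)^n`. -/
noncomputable def A_C (F : Type*) [Field F] [Fintype F] (n r d : ℕ) : ℕ :=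
  sSup {c : ℕ | ∃ S : Set (Submodule F (Fin n → F)), S.Nonempty ∧
    (∀ U ∈ S, finrank F ↥U = r) ∧
    (∀ U ∈ S, ∀ V ∈ S, U ≠ V → d ≤ injDist U V) ∧ S.ncard = c}

/-- `N_R(q,m,n,r)` : number of `m × n` matrices over `GF(q)` of rank `r`. -/
noncomputable def N_R (F : Type*) [Field F] [Fintype F] (m n r : ℕ) : ℕ :=
  Nat.card {X : Matrix (Fin m) (Fin n) F // X.rank = r}

/-- `α(m,s) = ∏_{i=0}^{s-1} (q^m - q^i)`. -/
def alphaq (q m s : ℕ) : ℕ := ∏ i ∈ Finset.range s, (q ^ m - q ^ i)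

/-- The Gaussian binomial `[n r]_q = α(n,r) / α(r,r)`. -/
def gaussBinom (q n r : ℕ) : ℕ := alphaq q n r / alphaq q r r

/-- `K_q = ∏_{j=1}^∞ (1 - q^{-j})`. -/
noncomputable def Kq (q : ℕ) : ℝ := ∏' j : ℕ, (1 - ((q : ℝ))⁻¹ ^ (j + 1))

/-- `M(q,m,n,d,r)` : the number of codewords of rank `r` in an `(n, n-d+1, d)` linear MRD
code over `GF(q^m)`. -/
def Mcount (q m n d r : ℕ) : ℤ :=
  (gaussBinom q n r : ℤ) *
    ∑ j ∈ Finset.Icc d r, (-1 : ℤ) ^ (r - j) * (gaussBinom q r j : ℤ) *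
      (q : ℤ) ^ ((r - j) * (r - j - 1) / 2) * ((q : ℤ) ^ (m * (j - d + 1)) - 1)

lemma exists_surj {F V W : Type*} [Field F] [AddCommGroup V] [Module F V] [AddCommGroup W]
    [Module F W] [FiniteDimensional F V] [FiniteDimensional F W]
    (h : finrank F W ≤ finrank F V) : ∃ f : V →ₗ[F] W, Function.Surjective f := by
  let e1 : V ≃ₗ[F] (Fin (finrank F V) → F) := LinearEquiv.ofFinrankEq _ _ (by simp)
  let e2 : (Fin (finrank F W) → F) ≃ₗ[F] W := LinearEquiv.ofFinrankEq _ _ (by simp)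
  refine ⟨e2.toLinearMap ∘ₗ LinearMap.funLeft F F (Fin.castLE h) ∘ₗ e1.toLinearMap, ?_⟩
  exact e2.surjective.comp ((LinearMap.funLeft_surjective_of_injective F F _
    (Fin.castLE_injective h)).comp e1.surjective)

lemma exists_inj {F V W : Type*} [Field F] [AddCommGroup V] [Module F V] [AddCommGroup W]
    [Module F W] [FiniteDimensional F V] [FiniteDimensional F W]
    (h : finrank F W ≤ finrank F V) : ∃ f : W →ₗ[F] V, Function.Injective f := by
  obtain ⟨f, hf⟩ := exists_surj h
  obtain ⟨g, hg⟩ := LinearMap.exists_rightInverse_of_surjective f (LinearMap.range_eq_top.2 hf)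
  exact ⟨g, Function.LeftInverse.injective (g := f) fun x => LinearMap.congr_fun hg x⟩

lemma finrank_map_inj {F V W : Type*} [Field F] [AddCommGroup V] [Module F V] [AddCommGroup W]
    [Module F W] {f : V →ₗ[F] W} (hf : Function.Injective f) (U : Submodule F V) :
    finrank F (U.map f) = finrank F U :=
  (Submodule.equivMapOfInjective f hf U).symm.finrank_eq

lemma exists_ext (F : Type*) [Field F] [Fintype F] (N : ℕ) (hN : 1 ≤ N) :
    ∃ (K : Type) (_ : Field K) (_ : Fintype K) (_ : Algebra F K), finrank F K = N := by
  obtain ⟨p, hp⟩ := CharP.exists F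
  have : Fact p.Prime := ⟨CharP.char_is_prime F p⟩
  have : NeZero N := ⟨by omega⟩
  exact ⟨FiniteField.Extension F p N, inferInstance, Fintype.ofFinite _, inferInstance,
    FiniteField.finrank_extension F p N⟩

open Polynomial in
lemma subspace_poly {F K : Type*} [Field F] [Fintype F] [Field K] [Fintype K] [Algebra F K]
    (W : Submodule F K) :
    ∃ (f : K →ₗ[F] K) (P : K[X]), P.Monic ∧ P.natDegree = Fintype.card F ^ finrank F W ∧
      (∀ x, f x = P.eval x) ∧ (∀ x, f x = 0 ↔ x ∈ W) := by
  classical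
  let P : K[X] := ∏ w : W, (X - C (w : K))
  have hmon : P.Monic := monic_prod_of_monic _ _ fun w _ => monic_X_sub_C _
  have hcard : Fintype.card W = Fintype.card F ^ finrank F W := Module.card_eq_pow_finrank
  have hdeg : P.natDegree = Fintype.card W := by
    rw [natDegree_prod_of_monic _ _ fun w _ => monic_X_sub_C _]; simp
  have hpos : 0 < P.natDegree := by rw [hdeg]; exact Fintype.card_pos
  have hev : ∀ x, P.eval x = ∏ w : W, (x - (w : K)) := fun x => by
    simp [P, eval_prod]
  have hzero : ∀ x, P.eval x = 0 ↔ x ∈ W := fun x => by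
    rw [hev, Finset.prod_eq_zero_iff]
    constructor
    · rintro ⟨w, _, hw⟩
      rw [sub_eq_zero.1 hw]; exact w.2
    · intro hx; exact ⟨⟨x, hx⟩, Finset.mem_univ _, sub_self _⟩
  have hshift : ∀ w : W, ∀ y : K, P.eval ((w : K) + y) = P.eval y := fun w y => by
    rw [hev, hev, ← Equiv.prod_comp (Equiv.addLeft w)]
    refine Finset.prod_congr rfl fun w' _ => ?_
    simp
  have key : ∀ A B : K[X], A.natDegree = P.natDegree → B.natDegree = P.natDegree →
      A.leadingCoeff = B.leadingCoeff → A ≠ 0 → B ≠ 0 → (∀ w : W, A.eval (w : K) = B.eval (w : K)) →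
      A = B := by
    intro A B hA hB hl hA0 hB0 he
    refine eq_of_degree_sub_lt_of_eval_finset_eq (Finset.univ.image (fun w : W => (w : K))) ?_ ?_
    · rw [Finset.card_image_of_injective _ Subtype.val_injective, Finset.card_univ, ← hdeg, ← hA,
        ← degree_eq_natDegree hA0]
      exact degree_sub_lt_left (by rw [degree_eq_natDegree hA0, degree_eq_natDegree hB0, hA, hB])
        hA0 hl
    · intro x hx
      obtain ⟨w, _, rfl⟩ := Finset.mem_image.1 hx
      exact he w
  have hadd : ∀ x y, P.eval (x + y) = P.eval x + P.eval y := by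
    intro x y
    have h1 : (P.comp (X + C y)).Monic := hmon.comp_X_add_C y
    have h2 : (P + C (P.eval y)).Monic :=
      hmon.add_of_left (lt_of_le_of_lt degree_C_le (natDegree_pos_iff_degree_pos.1 hpos))
    have := key (P.comp (X + C y)) (P + C (P.eval y)) (by simp [natDegree_comp]) (by simp)
      (by rw [h1.leadingCoeff, h2.leadingCoeff]) h1.ne_zero h2.ne_zero (fun w => by
        simp [hshift, (hzero w).2 w.2])
    simpa using congrArg (eval x) this
  have hsmul : ∀ (c : F) x, P.eval (c • x) = c • P.eval x := by
    intro c x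
    by_cases hc : c = 0
    · subst hc
      simp [(hzero 0).2 W.zero_mem]
    have hc' : algebraMap F K c ≠ 0 := by simpa using hc
    have hl : (P.comp (C (algebraMap F K c) * X)).leadingCoeff = algebraMap F K c := by
      rw [leadingCoeff_comp (by rw [natDegree_C_mul_X _ hc']; simp), hmon.leadingCoeff,
        leadingCoeff_C_mul_X, hdeg, hcard, ← map_pow, FiniteField.pow_card_pow, one_mul]
    have hl2 : (C (algebraMap F K c) * P).leadingCoeff = algebraMap F K c := by
      rw [leadingCoeff_mul, hmon.leadingCoeff, leadingCoeff_C, mul_one]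
    have := key (P.comp (C (algebraMap F K c) * X)) (C (algebraMap F K c) * P)
      (by rw [natDegree_comp, natDegree_C_mul_X _ hc', mul_one])
      (by rw [natDegree_C_mul hc']) (by rw [hl, hl2])
      (by intro h; rw [h] at hl; simp at hl; exact hc' hl.symm)
      (by intro h; rw [h] at hl2; simp at hl2; exact hc' hl2.symm) (fun w => by
        simp only [eval_comp, eval_mul, eval_C, eval_X, (hzero w).2 w.2, mul_zero]
        rw [← Algebra.smul_def, hzero]
        exact W.smul_mem c w.2)
    simpa [Algebra.smul_def] using congrArg (eval x) this
  exact ⟨{ toFun := fun x => P.eval x, map_add' := hadd, map_smul' := hsmul }, P, hmon,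
    hdeg.trans hcard, fun x => rfl, hzero⟩

lemma rank_toMatrix {F : Type*} [Field F] {m n : ℕ} {V W : Type*}
    [AddCommGroup V] [Module F V] [AddCommGroup W] [Module F W]
    (b : Basis (Fin n) F V) (c : Basis (Fin m) F W) (T : V →ₗ[F] W) :
    (LinearMap.toMatrix b c T).rank = finrank F (LinearMap.range T) := by
  rw [Matrix.rank_eq_finrank_range_toLin _ c b, Matrix.toLin_toMatrix]

/-- code from a family of linear maps -/
lemma code_of_maps {F : Type*} [Field F] {m n d r : ℕ} (hd : 1 ≤ d) {ι V W : Type*}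
    [AddCommGroup V] [Module F V] [AddCommGroup W] [Module F W]
    [FiniteDimensional F V] [FiniteDimensional F W]
    (hV : finrank F V = n) (hW : finrank F W = m)
    (S : Set ι) (hS : S.Nonempty) (T : ι → V →ₗ[F] W)
    (h1 : ∀ i ∈ S, finrank F (LinearMap.range (T i)) = r)
    (h2 : ∀ i ∈ S, ∀ j ∈ S, i ≠ j → d + r ≤ finrank F (LinearMap.range (T i - T j))) :
    ∃ C : Set (Matrix (Fin m) (Fin n) F), C.Nonempty ∧ (∀ X ∈ C, X.rank = r) ∧
      (∀ X ∈ C, ∀ Y ∈ C, X ≠ Y → d + r ≤ (X - Y).rank) ∧ C.ncard = S.ncard := by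
  let b := finBasisOfFinrankEq F V hV
  let c := finBasisOfFinrankEq F W hW
  have hdiff : ∀ i ∈ S, ∀ j ∈ S, i ≠ j →
      d + r ≤ (LinearMap.toMatrix b c (T i) - LinearMap.toMatrix b c (T j)).rank := by
    intro i hi j hj hij
    rw [← map_sub, rank_toMatrix]
    exact h2 i hi j hj hij
  refine ⟨(fun i => LinearMap.toMatrix b c (T i)) '' S, hS.image _, ?_, ?_, ?_⟩
  · rintro _ ⟨i, hi, rfl⟩
    rw [rank_toMatrix]; exact h1 i hi
  · rintro _ ⟨i, hi, rfl⟩ _ ⟨j, hj, rfl⟩ hne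
    exact hdiff i hi j hj (fun h => hne (by rw [h]))
  · refine Set.ncard_image_of_injOn ?_
    intro i hi j hj hij
    by_contra hne
    have := hdiff i hi j hj hne
    simp only at hij
    rw [hij, sub_self, Matrix.rank_zero] at this
    omega

/-- transposed version -/
lemma code_of_maps' {F : Type*} [Field F] {m n d r : ℕ} (hd : 1 ≤ d) {ι V W : Type*}
    [AddCommGroup V] [Module F V] [AddCommGroup W] [Module F W]
    [FiniteDimensional F V] [FiniteDimensional F W]
    (hV : finrank F V = n) (hW : finrank F W = m)
    (S : Set ι) (hS : S.Nonempty) (T : ι → W →ₗ[F] V)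
    (h1 : ∀ i ∈ S, finrank F (LinearMap.range (T i)) = r)
    (h2 : ∀ i ∈ S, ∀ j ∈ S, i ≠ j → d + r ≤ finrank F (LinearMap.range (T i - T j))) :
    ∃ C : Set (Matrix (Fin m) (Fin n) F), C.Nonempty ∧ (∀ X ∈ C, X.rank = r) ∧
      (∀ X ∈ C, ∀ Y ∈ C, X ≠ Y → d + r ≤ (X - Y).rank) ∧ C.ncard = S.ncard := by
  refine code_of_maps hd (V := Dual F V) (W := Dual F W) (by rw [Subspace.dual_finrank_eq, hV])
    (by rw [Subspace.dual_finrank_eq, hW]) S hS (fun i => (T i).dualMap) ?_ ?_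
  · intro i hi
    rw [LinearMap.finrank_range_dualMap_eq_finrank_range, h1 i hi]
  · intro i hi j hj hij
    have : (T i).dualMap - (T j).dualMap = (T i - T j).dualMap := by
      ext; simp
    rw [this, LinearMap.finrank_range_dualMap_eq_finrank_range]
    exact h2 i hi j hj hij

/-- code from surjections onto the subspaces, pairwise jointly surjective -/
lemma code_of_surj {F : Type*} [Field F] {m n d r : ℕ} (hd : 1 ≤ d) {W : Type*}
    [AddCommGroup W] [Module F W] [FiniteDimensional F W] (hW : finrank F W = m)
    (S : Set (Submodule F (Fin n → F))) (hS : S.Nonempty)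
    (hr : ∀ U ∈ S, finrank F ↥U = r)
    (hdd : ∀ U ∈ S, ∀ V ∈ S, U ≠ V → d ≤ injDist U V)
    (Q : (U : Submodule F (Fin n → F)) → W →ₗ[F] U)
    (h1 : ∀ U ∈ S, Function.Surjective (Q U))
    (h2 : ∀ U ∈ S, ∀ V ∈ S, U ≠ V → ∀ (s : U) (t : V), ∃ w, Q U w = s ∧ Q V w = t) :
    ∃ C : Set (Matrix (Fin m) (Fin n) F), C.Nonempty ∧ (∀ X ∈ C, X.rank = r) ∧
      (∀ X ∈ C, ∀ Y ∈ C, X ≠ Y → d + r ≤ (X - Y).rank) ∧ C.ncard = S.ncard := by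
  refine code_of_maps' hd (V := Fin n → F) (by simp) hW S hS (fun U => U.subtype ∘ₗ Q U) ?_ ?_
  · intro U hU
    rw [LinearMap.range_comp_of_range_eq_top _ (LinearMap.range_eq_top.2 (h1 U hU)),
      Submodule.range_subtype, hr U hU]
  · intro U hU V hV hUV
    have hle : U ⊔ V ≤ LinearMap.range (U.subtype ∘ₗ Q U - V.subtype ∘ₗ Q V) := by
      intro x hx
      obtain ⟨s, hs, t, ht, rfl⟩ := Submodule.mem_sup.1 hx
      obtain ⟨w, hw1, hw2⟩ := h2 U hU V hV hUV ⟨s, hs⟩ (-⟨t, ht⟩)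
      refine ⟨w, ?_⟩
      simp [hw1, hw2]
    have h3 := Submodule.finrank_mono hle
    have h4 := hdd U hU V hV hUV
    unfold injDist at h4
    rw [hr U hU, hr V hV, min_self] at h4
    omega

lemma arith1 (q r k : ℕ) (hq : 2 ≤ q) (hk : k ≤ r) :
    q ^ (r * k) * (q ^ r - q ^ k) ≤ q ^ r * ∏ i ∈ Finset.range k, (q ^ r - q ^ i) := by
  induction k with
  | zero => simp
  | succ k ih =>
    have ih := ih (by omega)
    rw [Finset.prod_range_succ, ← mul_assoc]
    refine le_trans ?_ (Nat.mul_le_mul_right _ ih)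
    rw [mul_assoc, mul_add, mul_one, pow_add, mul_assoc]
    refine Nat.mul_le_mul_left _ ?_
    have h1 : q ^ k ≤ q ^ r := Nat.pow_le_pow_right (by omega) (by omega)
    have h2 : q ^ (k+1) ≤ q ^ r := Nat.pow_le_pow_right (by omega) (by omega)
    have h3 : 2 * q ^ k ≤ q ^ (k+1) := by rw [pow_succ, mul_comm]; exact Nat.mul_le_mul_left _ hq
    zify [h1, h2]
    have h3' : (2:ℤ) * q ^ k ≤ q ^ (k+1) := by exact_mod_cast h3
    have h0 : (0:ℤ) ≤ (q:ℤ) ^ r := by positivity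
    nlinarith [sq_nonneg ((q:ℤ)^k), mul_le_mul_of_nonneg_left h3' h0]

lemma packing {F V : Type*} [Field F] [Fintype F] [AddCommGroup V] [Module F V] [Fintype V]
    (k r : ℕ) (hkr : k ≤ r) (hrn : r ≤ finrank F V) (S : Set (Submodule F V))
    (hr : ∀ U ∈ S, finrank F ↥U = r)
    (hS : ∀ U ∈ S, ∀ W ∈ S, U ≠ W → finrank F ↥(U ⊓ W) < k) :
    S.ncard * ∏ i ∈ Finset.range k, (Fintype.card F ^ r - Fintype.card F ^ i) ≤
      ∏ i ∈ Finset.range k, (Fintype.card F ^ finrank F V - Fintype.card F ^ i) := by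
  classical
  have hA := card_linearIndependent (K := F) (V := V) (k := k) (hkr.trans hrn)
  have hB : ∀ U : S, Nat.card { s : Fin k → U.1 // LinearIndependent F s } =
      ∏ i ∈ Finset.range k, (Fintype.card F ^ r - Fintype.card F ^ i) := by
    intro U
    rw [card_linearIndependent (K := F) (by rw [hr _ U.2]; exact hkr), hr _ U.2,
      ← Fin.prod_univ_eq_prod_range (fun i => Fintype.card F ^ r - Fintype.card F ^ i)]
  rw [Fin.prod_univ_eq_prod_range (fun i => Fintype.card F ^ finrank F V - Fintype.card F ^ i)] at hA
  rw [← hA]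
  let f : (Σ U : S, { s : Fin k → U.1 // LinearIndependent F s }) →
      { s : Fin k → V // LinearIndependent F s } := fun x =>
    ⟨fun i => (x.2.1 i : V), x.2.2.map' x.1.1.subtype (Submodule.ker_subtype _)⟩
  have hf : Function.Injective f := by
    rintro ⟨⟨U, hU⟩, s, hs⟩ ⟨⟨W, hW⟩, t, ht⟩ h
    have h' : ∀ i, (s i : V) = t i := fun i => congrFun (congrArg Subtype.val h) i
    have hUW : U = W := by
      by_contra hne
      have hlt := hS U hU W hW hne
      have hli : LinearIndependent F (fun i => (⟨s i, (s i).2, by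
          rw [h' i]; exact (t i).2⟩ : ↥(U ⊓ W))) := by
        refine LinearIndependent.of_comp (U ⊓ W).subtype ?_
        exact hs.map' U.subtype (Submodule.ker_subtype _)
      have := hli.fintype_card_le_finrank
      rw [Fintype.card_fin] at this
      omega
    subst hUW
    have : s = t := funext fun i => Subtype.ext (h' i)
    subst this
    rfl
  have := Nat.card_le_card_of_injective f hf
  rw [Nat.card_sigma] at this
  simp only [hB] at this
  rw [Finset.sum_const, Finset.card_univ, smul_eq_mul, ← Nat.card_eq_fintype_card,
    Nat.card_coe_set_eq] at this
  exact this

lemma code_bound {F : Type*} [Field F] [Fintype F] {m n d r : ℕ}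
    (h2r : 2 * r ≤ n) (hd : 2 ≤ d) (hdr : d ≤ r)
    (hm : (n - r) * (r - d + 1) + r + 1 ≤ m)
    (S : Set (Submodule F (Fin n → F)))
    (hr : ∀ U ∈ S, finrank F ↥U = r)
    (hdd : ∀ U ∈ S, ∀ V ∈ S, U ≠ V → d ≤ injDist U V) :
    S.ncard ≤ Fintype.card F ^ (m - r) := by
  classical
  have hq : 2 ≤ Fintype.card F := Fintype.one_lt_card
  have hp := packing (F := F) (r - d + 1) r (by omega) (by simp; omega) S hr (by
    intro U hU W hW hne
    have h4 := hdd U hU W hW hne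
    have h5 := Submodule.finrank_sup_add_finrank_inf_eq U W
    unfold injDist at h4
    rw [hr U hU, hr W hW, min_self] at h4
    rw [hr U hU, hr W hW] at h5
    omega)
  rw [finrank_fin_fun] at hp
  have ha := arith1 (Fintype.card F) r (r - d + 1) hq (by omega)
  generalize hk : r - d + 1 = k at *
  generalize Fintype.card F = q at *
  have hup : ∏ i ∈ Finset.range k, (q ^ n - q ^ i) ≤ q ^ (n * k) := by
    calc _ ≤ ∏ i ∈ Finset.range k, q ^ n := Finset.prod_le_prod' fun i _ => Nat.sub_le _ _
      _ = _ := by simp [pow_mul]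
  generalize ∏ i ∈ Finset.range k, (q ^ r - q ^ i) = P at *
  have hqk : 2 * q ^ k ≤ q ^ r := by
    calc 2 * q ^ k ≤ q * q ^ k := Nat.mul_le_mul_right _ hq
      _ = q ^ (k + 1) := by ring
      _ ≤ q ^ r := Nat.pow_le_pow_right (by omega) (by omega)
  have hP : q ^ (r * k) ≤ 2 * P := by
    have h0 : 0 < q ^ r := by positivity
    refine Nat.le_of_mul_le_mul_left ?_ h0
    calc q ^ r * q ^ (r * k) ≤ 2 * (q ^ (r * k) * (q ^ r - q ^ k)) := by
          have : q ^ r ≤ 2 * (q ^ r - q ^ k) := by omega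
          calc _ ≤ 2 * (q ^ r - q ^ k) * q ^ (r * k) := Nat.mul_le_mul_right _ this
            _ = _ := by ring
      _ ≤ 2 * (q ^ r * P) := Nat.mul_le_mul_left _ ha
      _ = _ := by ring
  have h0 : 0 < q ^ (r * k) := by positivity
  refine Nat.le_of_mul_le_mul_right ?_ h0
  calc S.ncard * q ^ (r * k) ≤ S.ncard * (2 * P) := Nat.mul_le_mul_left _ hP
    _ = 2 * (S.ncard * P) := by ring
    _ ≤ 2 * q ^ (n * k) := Nat.mul_le_mul_left _ (hp.trans hup)
    _ ≤ q * q ^ (n * k) := Nat.mul_le_mul_right _ hq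
    _ = q ^ ((n - r) * k + 1) * q ^ (r * k) := by
        obtain ⟨t, rfl⟩ := Nat.exists_eq_add_of_le (show r ≤ n by omega)
        rw [Nat.add_sub_cancel_left]; ring
    _ ≤ q ^ (m - r) * q ^ (r * k) :=
        Nat.mul_le_mul_right _ (Nat.pow_le_pow_right (by omega) (by omega))

lemma core_one {F : Type*} [Field F] [Fintype F] {m n r : ℕ} (hr1 : 1 ≤ r)
    (h2r : 2 * r ≤ n) (hnm : n ≤ m)
    (S : Set (Submodule F (Fin n → F))) (hS : S.Nonempty)
    (hr : ∀ U ∈ S, finrank F ↥U = r) :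
    ∃ C : Set (Matrix (Fin m) (Fin n) F), C.Nonempty ∧ (∀ X ∈ C, X.rank = r) ∧
      (∀ X ∈ C, ∀ Y ∈ C, X ≠ Y → 1 + r ≤ (X - Y).rank) ∧ C.ncard = S.ncard := by
  classical
  obtain ⟨K, _, _, _, hK⟩ := exists_ext F m (by omega)
  have hD : finrank F (Dual F (Fin n → F)) = n := by rw [Subspace.dual_finrank_eq]; simp
  obtain ⟨A, hA⟩ : ∃ A : Dual F (Fin n → F) →ₗ[F] K, Function.Injective A :=
    exists_inj (by omega)
  choose f P hmon hdeg hfP hf0 using fun U : Submodule F (Fin n → F) =>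
    subspace_poly (F := F) (K := K) (U.dualAnnihilator.map A)
  have hdeg' : ∀ U ∈ S, (P U).natDegree = Fintype.card F ^ (n - r) := by
    intro U hU
    rw [hdeg, finrank_map_inj hA]
    have := Subspace.finrank_add_finrank_dualAnnihilator_eq U
    rw [hr U hU, finrank_fin_fun] at this
    congr 1; omega
  refine code_of_maps le_rfl hD hK S hS (fun U => f U ∘ₗ A) ?_ ?_
  · intro U hU
    have hker : LinearMap.ker (f U ∘ₗ A) = U.dualAnnihilator := by
      ext x
      rw [LinearMap.mem_ker, LinearMap.comp_apply, hf0, Submodule.mem_map]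
      constructor
      · rintro ⟨y, hy, h⟩; rwa [← hA h]
      · intro h; exact ⟨x, h, rfl⟩
    have h1 := LinearMap.finrank_range_add_finrank_ker (f U ∘ₗ A)
    rw [hker] at h1
    have := Subspace.finrank_add_finrank_dualAnnihilator_eq U
    rw [hr U hU, finrank_fin_fun] at this
    omega
  · intro U hU V hV hUV
    have hne : P U - P V ≠ 0 := by
      intro h
      apply hUV
      have hPP := sub_eq_zero.1 h
      rw [← Subspace.dualAnnihilator_inj]
      apply Submodule.map_injective_of_injective hA
      ext x
      rw [← hf0, ← hf0, hfP, hfP, hPP]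
    have hlt : (P U - P V).natDegree < Fintype.card F ^ (n - r) := by
      rw [← hdeg' U hU]
      refine Polynomial.natDegree_lt_natDegree hne ?_
      refine Polynomial.degree_sub_lt_left ?_ (hmon U).ne_zero (by
        rw [(hmon U).leadingCoeff, (hmon V).leadingCoeff])
      rw [Polynomial.degree_eq_natDegree (hmon U).ne_zero,
        Polynomial.degree_eq_natDegree (hmon V).ne_zero, hdeg' U hU, hdeg' V hV]
    have hfin : Finite (Dual F (Fin n → F)) := Finite.of_injective A hA
    letI : Fintype (Dual F (Fin n → F)) := Fintype.ofFinite _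
    set T := f U ∘ₗ A - f V ∘ₗ A with hT
    have hc : Fintype.card (LinearMap.ker T) < Fintype.card F ^ (n - r) := by
      refine lt_of_le_of_lt ?_ hlt
      have := Polynomial.card_le_degree_of_subset_roots (p := P U - P V)
        (Z := Finset.univ.image (A ∘ (Subtype.val : LinearMap.ker T → _))) (by
          intro y hy
          obtain ⟨x, _, rfl⟩ := Finset.mem_image.1 hy
          rw [Polynomial.mem_roots hne, Polynomial.IsRoot, Function.comp_apply, Polynomial.eval_sub, ← hfP, ← hfP]
          have : T x.1 = 0 := LinearMap.mem_ker.1 x.2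
          exact this)
      rwa [Finset.card_image_of_injective _ (hA.comp Subtype.val_injective),
        Finset.card_univ] at this
    rw [Module.card_eq_pow_finrank (K := F)] at hc
    have hk := (Nat.pow_lt_pow_iff_right (Fintype.one_lt_card (α := F))).1 hc
    have h1 := LinearMap.finrank_range_add_finrank_ker T
    omega

lemma core_eq {F : Type*} [Field F] [Fintype F] {m n r : ℕ} (hr1 : 1 ≤ r)
    (hnm : n ≤ m)
    (S : Set (Submodule F (Fin n → F))) (hS : S.Nonempty)
    (hr : ∀ U ∈ S, finrank F ↥U = r)
    (hdd : ∀ U ∈ S, ∀ V ∈ S, U ≠ V → r ≤ injDist U V) :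
    ∃ C : Set (Matrix (Fin m) (Fin n) F), C.Nonempty ∧ (∀ X ∈ C, X.rank = r) ∧
      (∀ X ∈ C, ∀ Y ∈ C, X ≠ Y → r + r ≤ (X - Y).rank) ∧ C.ncard = S.ncard := by
  obtain ⟨B, hB⟩ : ∃ B : (Fin m → F) →ₗ[F] Dual F (Fin n → F), Function.Surjective B :=
    exists_surj (by rw [Subspace.dual_finrank_eq]; simpa using hnm)
  let e : (U : Submodule F (Fin n → F)) → Dual F U ≃ₗ[F] U := fun U =>
    LinearEquiv.ofFinrankEq _ _ Subspace.dual_finrank_eq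
  have hsingle : ∀ (U : Submodule F (Fin n → F)) (φ : Dual F U), ∃ g : Dual F (Fin n → F),
      g ∘ₗ U.subtype = φ := fun U φ => LinearMap.exists_extend φ
  refine code_of_surj hr1 (W := Fin m → F) (by simp) S hS hr hdd
    (fun U => (e U).toLinearMap ∘ₗ U.subtype.dualMap ∘ₗ B) ?_ ?_
  · intro U hU s
    obtain ⟨g, hg⟩ := hsingle U ((e U).symm s)
    obtain ⟨w, rfl⟩ := hB g
    refine ⟨w, ?_⟩
    have : U.subtype.dualMap (B w) = (e U).symm s := hg
    simp [this]
  · intro U hU V hV hUV s t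
    have hinf : U ⊓ V = ⊥ := by
      have h4 := hdd U hU V hV hUV
      have h5 := Submodule.finrank_sup_add_finrank_inf_eq U V
      unfold injDist at h4
      rw [hr U hU, hr V hV, min_self] at h4
      rw [hr U hU, hr V hV] at h5
      exact Submodule.finrank_eq_zero.1 (by omega)
    have hinj : Function.Injective (LinearMap.coprod U.subtype V.subtype) := by
      rw [← LinearMap.ker_eq_bot, LinearMap.ker_coprod_of_disjoint_range]
      · simp
      · simpa [disjoint_iff] using hinf
    obtain ⟨L, hL⟩ := LinearMap.exists_leftInverse_of_injective _ (LinearMap.ker_eq_bot.2 hinj)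
    let g : Dual F (Fin n → F) := LinearMap.coprod ((e U).symm s) ((e V).symm t) ∘ₗ L
    obtain ⟨w, hw⟩ := hB g
    have hU' : U.subtype.dualMap (B w) = (e U).symm s := by
      ext x
      have := LinearMap.congr_fun hL (x, 0)
      simp at this
      simp [hw, g, this]
    have hV' : V.subtype.dualMap (B w) = (e V).symm t := by
      ext x
      have := LinearMap.congr_fun hL (0, x)
      simp at this
      simp [hw, g, this]
    exact ⟨w, by simp [hU'], by simp [hV']⟩

lemma core_two {F : Type*} [Field F] [Fintype F] {m n d r : ℕ}
    (h2r : 2 * r ≤ n) (hnm : n ≤ m) (hd : 2 ≤ d) (hdr : d ≤ r)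
    (hm : (n - r) * (r - d + 1) + r + 1 ≤ m)
    (S : Set (Submodule F (Fin n → F))) (hS : S.Nonempty)
    (hr : ∀ U ∈ S, finrank F ↥U = r)
    (hdd : ∀ U ∈ S, ∀ V ∈ S, U ≠ V → d ≤ injDist U V) :
    ∃ C : Set (Matrix (Fin m) (Fin n) F), C.Nonempty ∧ (∀ X ∈ C, X.rank = r) ∧
      (∀ X ∈ C, ∀ Y ∈ C, X ≠ Y → d + r ≤ (X - Y).rank) ∧ C.ncard = S.ncard := by
  classical
  obtain ⟨K, _, _, _, hK⟩ := exists_ext F (m - r) (by omega)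
  have hb := code_bound h2r hd hdr hm S hr hdd
  rw [← hK, ← Module.card_eq_pow_finrank] at hb
  obtain ⟨a, ha⟩ : ∃ a : Submodule F (Fin n → F) → K, Set.InjOn a S := by
    have : Fintype S := Fintype.ofFinite S
    rw [← Nat.card_coe_set_eq, Nat.card_eq_fintype_card] at hb
    obtain ⟨g⟩ := Function.Embedding.nonempty_of_card_le hb
    refine ⟨fun U => if h : U ∈ S then g ⟨U, h⟩ else 0, ?_⟩
    intro U hU V hV h
    simp only [hU, hV, dif_pos] at h
    exact congrArg Subtype.val (g.injective h)
  obtain ⟨L, hL⟩ : ∃ L : K →ₗ[F] (Fin r → F), Function.Surjective L :=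
    exists_surj (by rw [hK]; simp; omega)
  have hex : ∀ U : Submodule F (Fin n → F), ∃ e : (Fin r → F) →ₗ[F] U, U ∈ S →
      Function.Bijective e := by
    intro U
    by_cases hU : U ∈ S
    · exact ⟨(LinearEquiv.ofFinrankEq (Fin r → F) U (by rw [hr U hU]; simp)).toLinearMap,
        fun _ => LinearEquiv.bijective _⟩
    · exact ⟨0, fun h => absurd h hU⟩
  choose e he using hex
  refine code_of_surj (by omega) (W := (Fin r → F) × K) (by simp [hK]; omega) S hS hr hdd
    (fun U => e U ∘ₗ LinearMap.coprod LinearMap.id (L ∘ₗ LinearMap.mulLeft F (a U))) ?_ ?_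
  · intro U hU s
    obtain ⟨v, rfl⟩ := (he U hU).2 s
    exact ⟨(v, 0), by simp⟩
  · intro U hU V hV hUV s t
    obtain ⟨v, rfl⟩ := (he U hU).2 s
    obtain ⟨w, rfl⟩ := (he V hV).2 t
    have hne : a U - a V ≠ 0 := fun h => hUV (ha hU hV (sub_eq_zero.1 h))
    obtain ⟨z, hz⟩ := hL (v - w)
    have h1 : a V * ((a U - a V)⁻¹ * z) = a U * ((a U - a V)⁻¹ * z) - z := by
      field_simp; ring
    refine ⟨(v - L (a U * ((a U - a V)⁻¹ * z)), (a U - a V)⁻¹ * z), ?_, ?_⟩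
    · simp
    · simp only [LinearMap.comp_apply, LinearMap.coprod_apply, LinearMap.mulLeft_apply,
        LinearMap.id_apply]
      rw [h1, map_sub, hz]
      congr 1
      abel

lemma finrank_rowSpace {F : Type*} [Field F] {m n : ℕ} (X : Matrix (Fin m) (Fin n) F) :
    finrank F (rowSpace X) = X.rank := by
  rw [← Matrix.rank_transpose, Matrix.rank, rowSpace, Matrix.mulVecLin_transpose]

lemma rank_sub_le_sup {F : Type*} [Field F] {m n : ℕ} (X Y : Matrix (Fin m) (Fin n) F) :
    (X - Y).rank ≤ finrank F ↥(rowSpace X ⊔ rowSpace Y) := by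
  rw [← finrank_rowSpace]
  apply Submodule.finrank_mono
  rintro _ ⟨v, rfl⟩
  rw [Matrix.vecMulLinear_apply, Matrix.vecMul_sub]
  exact Submodule.sub_mem _ (Submodule.mem_sup_left ⟨v, rfl⟩) (Submodule.mem_sup_right ⟨v, rfl⟩)

theorem stmt6 {q m n d r : ℕ} (F : Type*) [Field F] [Fintype F] (hF : Fintype.card F = q)
    (h2r : 2 * r ≤ n) (hnm : n ≤ m) (hd1 : 1 ≤ d) (hdr : d ≤ r)
    (hcase : d = r ∨ (n - r) * (r - d + 1) + r + 1 ≤ m)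
    (C : Set (Matrix (Fin m) (Fin n) F)) (hne : C.Nonempty)
    (hrk : ∀ X ∈ C, X.rank = r)
    (hdist : ∀ X ∈ C, ∀ Y ∈ C, X ≠ Y → d + r ≤ (X - Y).rank)
    (hopt : C.ncard = A_R F m n (d + r) r) :
    (∀ U ∈ rowSpace '' C, finrank F ↥U = r) ∧
      (∀ U ∈ rowSpace '' C, ∀ V ∈ rowSpace '' C, U ≠ V → d ≤ injDist U V) ∧
      (rowSpace '' C).ncard = A_C F n r d := by
  classical
  have h1 : ∀ U ∈ rowSpace '' C, finrank F ↥U = r := by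
    rintro _ ⟨X, hX, rfl⟩
    rw [finrank_rowSpace, hrk X hX]
  have hsup : ∀ X ∈ C, ∀ Y ∈ C, X ≠ Y → d + r ≤ finrank F ↥(rowSpace X ⊔ rowSpace Y) :=
    fun X hX Y hY h => (hdist X hX Y hY h).trans (rank_sub_le_sup X Y)
  have h2 : ∀ U ∈ rowSpace '' C, ∀ V ∈ rowSpace '' C, U ≠ V → d ≤ injDist U V := by
    rintro _ ⟨X, hX, rfl⟩ _ ⟨Y, hY, rfl⟩ h
    have := hsup X hX Y hY (fun h' => h (by rw [h']))
    unfold injDist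
    rw [finrank_rowSpace, finrank_rowSpace, hrk X hX, hrk Y hY, min_self]
    omega
  have hinj : Set.InjOn rowSpace C := by
    intro X hX Y hY h
    by_contra hXY
    have := hsup X hX Y hY hXY
    rw [← h, sup_idem, finrank_rowSpace, hrk X hX] at this
    omega
  have hcard : (rowSpace '' C).ncard = C.ncard := Set.ncard_image_of_injOn hinj
  refine ⟨h1, h2, le_antisymm ?_ ?_⟩
  · refine le_csSup ⟨Nat.card (Submodule F (Fin n → F)), ?_⟩ ⟨_, hne.image _, h1, h2, rfl⟩
    rintro _ ⟨S, -, -, -, rfl⟩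
    exact Set.ncard_le_card S
  · rw [hcard, hopt]
    refine csSup_le ⟨_, _, hne.image _, h1, h2, rfl⟩ ?_
    rintro _ ⟨S, hS, hSr, hSd, rfl⟩
    obtain ⟨C', hC1, hC2, hC3, hC4⟩ : ∃ C : Set (Matrix (Fin m) (Fin n) F), C.Nonempty ∧
        (∀ X ∈ C, X.rank = r) ∧
        (∀ X ∈ C, ∀ Y ∈ C, X ≠ Y → d + r ≤ (X - Y).rank) ∧ C.ncard = S.ncard := by
      rcases hcase with rfl | hm
      · exact core_eq hd1 hnm S hS hSr hSd
      · rcases Nat.lt_or_ge d 2 with h | h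
        · obtain rfl : d = 1 := by omega
          exact core_one hdr h2r hnm S hS hSr
        · exact core_two h2r hnm h hdr hm S hS hSr hSd
    rw [← hC4]
    refine le_csSup ⟨Nat.card (Matrix (Fin m) (Fin n) F), ?_⟩ ⟨C', hC1, hC2, hC3, rfl⟩
    rintro _ ⟨S, -, -, -, rfl⟩
    exact Set.ncard_le_card S
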